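/- Let n, m, t be positive integers with t ≤ n, and let f = (f₁,…,f_m) : 𝔽₂ⁿ → 𝔽₂^m be a symmetric multi-output Boolean function (i.e., f(x_{π(1)},…,x_{π(n)}) = f(x₁,…,x_n) for every permutation π of {1,…,n}). Then f is a t-th order correlation-immune function if and only if ℱ_{v·f}(2^{n−t}) = ∑_{k=0}^{2ⁿ−1} (−1)^{(v·f)(k)} ξ^{−k·2^{n−t}} = 0 for every nonzero v ∈ 𝔽₂^m, where v·f = ∑_{i=1}^m v_i f_i (mod 2) and ξ = exp(2π√−1/2ⁿ). -/

import Mathlib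

noncomputable section

open Finset

/-- Inner product modulo 2 on `𝔽₂ⁿ`. -/
def dotp {n : ℕ} (c x : Fin n → ZMod 2) : ZMod 2 := ∑ j, c j * x j

/-- Hamming weight of a vector in `𝔽₂ⁿ`. -/
def wt {n : ℕ} (c : Fin n → ZMod 2) : ℕ := (Finset.univ.filter fun j => c j ≠ 0).card

/-- `f` is `t`-th order correlation-immune: fixing any `t` coordinates does not
change the output distribution (counting form). -/
def CI {n : ℕ} {A : Type*} (t : ℕ) (f : (Fin n → ZMod 2) → A) : Prop :=
  ∀ S : Finset (Fin n), S.card = t → ∀ a : Fin n → ZMod 2, ∀ α : A,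
    2 ^ t * Nat.card {x : Fin n → ZMod 2 // f x = α ∧ ∀ j ∈ S, x j = a j}
      = Nat.card {x : Fin n → ZMod 2 // f x = α}

/-- Binary expansion of `k` as a vector in `𝔽₂ⁿ`, `k = ∑ x_j 2^j`. -/
def bin (n k : ℕ) : Fin n → ZMod 2 := fun j => ((k / 2 ^ (j : ℕ)) % 2 : ℕ)

/-- `ω i = exp(2π√-1 / 2^i)`, a primitive `2^i`-th root of unity in `ℂ`. -/
def ω (i : ℕ) : ℂ := Complex.exp (2 * Real.pi * Complex.I / 2 ^ i)


/-- sign character -/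
def sgn (c : ZMod 2) : ℤ := (-1) ^ c.val

/-- partial sum over a subcube -/
def GG {n : ℕ} (e : (Fin n → ZMod 2) → ℤ) (S : Finset (Fin n)) (a : Fin n → ZMod 2) : ℤ :=
  ∑ x with ∀ j ∈ S, x j = a j, e x

lemma sgn_add (a b : ZMod 2) : sgn (a + b) = sgn a * sgn b := by
  revert a b; decide

lemma sgn_zero : sgn 0 = 1 := by decide

lemma sgn_sum {ι : Type*} (s : Finset ι) (g : ι → ZMod 2) :
    sgn (∑ i ∈ s, g i) = ∏ i ∈ s, sgn (g i) := by
  classical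
  induction s using Finset.induction_on with
  | empty => simp [sgn_zero]
  | insert i s hi ih => rw [Finset.sum_insert hi, Finset.prod_insert hi, sgn_add, ih]

lemma orth_one (y α : ZMod 2) :
    ∑ c : ZMod 2, sgn (c * y) * sgn (c * α) = if y = α then 2 else 0 := by
  revert y α; decide

lemma orth {m : ℕ} (y α : Fin m → ZMod 2) :
    ∑ v : Fin m → ZMod 2, sgn (∑ i, v i * y i) * sgn (∑ i, v i * α i)
      = if y = α then 2 ^ m else 0 := by
  simp_rw [sgn_sum, ← Finset.prod_mul_distrib]
  have := Finset.prod_univ_sum (fun _ : Fin m => (Finset.univ : Finset (ZMod 2)))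
    (fun i c => sgn (c * y i) * sgn (c * α i))
  rw [Fintype.piFinset_univ] at this
  rw [← this]
  simp_rw [orth_one]
  rw [Finset.prod_ite_zero]
  simp [funext_iff]

lemma card_agree {n : ℕ} (S : Finset (Fin n)) (a : Fin n → ZMod 2) :
    (Finset.univ.filter fun x : Fin n → ZMod 2 => ∀ j ∈ S, x j = a j).card
      = 2 ^ (n - S.card) := by
  have : (Finset.univ.filter fun x : Fin n → ZMod 2 => ∀ j ∈ S, x j = a j)
      = Fintype.piFinset (fun j => if j ∈ S then {a j} else Finset.univ) := by
    ext x
    simp only [Finset.mem_filter, Finset.mem_univ, true_and, Fintype.mem_piFinset]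
    refine forall_congr' fun j => ?_
    by_cases h : j ∈ S <;> simp [h]
  rw [this, Fintype.card_piFinset]
  have h2 : ∀ j, (if j ∈ S then ({a j} : Finset (ZMod 2)) else Finset.univ).card
      = if j ∈ S then 1 else 2 := by
    intro j; by_cases h : j ∈ S <;> simp [h, ZMod.card]
  simp_rw [h2]
  rw [Finset.prod_ite]
  simp only [Finset.prod_const, one_pow, one_mul]
  congr 1
  have h3 : (Finset.univ.filter fun j => j ∉ S) = Sᶜ := by ext; simp
  rw [h3, Finset.card_compl, Fintype.card_fin]

/-- count as an integer -/
def NN {n : ℕ} {A : Type*} [DecidableEq A] (f : (Fin n → ZMod 2) → A) (S : Finset (Fin n))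
    (a : Fin n → ZMod 2) (α : A) : ℤ := GG (fun x => if f x = α then 1 else 0) S a

lemma NN_eq {n : ℕ} {A : Type*} [DecidableEq A] (f : (Fin n → ZMod 2) → A) (S : Finset (Fin n))
    (a : Fin n → ZMod 2) (α : A) :
    NN f S a α = (Nat.card {x : Fin n → ZMod 2 // f x = α ∧ ∀ j ∈ S, x j = a j} : ℤ) := by
  rw [Nat.card_eq_fintype_card, Fintype.card_subtype, NN, GG, Finset.sum_boole,
    Finset.filter_filter]
  congr 2
  ext x; simp [and_comm]

lemma sum_GG {n : ℕ} (e : (Fin n → ZMod 2) → ℤ) (S : Finset (Fin n)) :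
    ∑ b, GG e S b = 2 ^ (n - S.card) * ∑ x, e x := by
  unfold GG
  simp_rw [Finset.sum_filter]
  rw [Finset.sum_comm, Finset.mul_sum]
  refine Finset.sum_congr rfl fun x _ => ?_
  rw [← Finset.sum_filter, Finset.sum_const, nsmul_eq_mul]
  have := card_agree S x
  simp_rw [eq_comm (a := x _)]
  rw [this]; push_cast; rfl

lemma GG_of_NN {n m : ℕ} (f : (Fin n → ZMod 2) → (Fin m → ZMod 2)) (S : Finset (Fin n))
    (a : Fin n → ZMod 2) (v : Fin m → ZMod 2) :
    GG (fun x => sgn (∑ i, v i * f x i)) S a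
      = ∑ α : Fin m → ZMod 2, sgn (∑ i, v i * α i) * NN f S a α := by
  unfold NN GG
  simp_rw [Finset.mul_sum]
  rw [Finset.sum_comm]
  refine Finset.sum_congr rfl fun x _ => ?_
  simp

lemma NN_of_GG {n m : ℕ} (f : (Fin n → ZMod 2) → (Fin m → ZMod 2)) (S : Finset (Fin n))
    (a : Fin n → ZMod 2) (α : Fin m → ZMod 2) :
    2 ^ m * NN f S a α = ∑ v : Fin m → ZMod 2,
      sgn (∑ i, v i * α i) * GG (fun x => sgn (∑ i, v i * f x i)) S a := by
  unfold NN GG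
  simp_rw [Finset.mul_sum]
  rw [Finset.sum_comm]
  refine Finset.sum_congr rfl fun x _ => ?_
  simp_rw [mul_comm (sgn (∑ i, _ * α i))]
  rw [orth]; simp

lemma CI_iff {n m t : ℕ} (htn : t ≤ n) (f : (Fin n → ZMod 2) → (Fin m → ZMod 2)) :
    CI t f ↔ ∀ v : Fin m → ZMod 2, v ≠ 0 → ∀ S : Finset (Fin n), S.card = t → ∀ a b,
      GG (fun x => sgn (∑ i, v i * f x i)) S a = GG (fun x => sgn (∑ i, v i * f x i)) S b := by
  constructor
  · intro h v _ S hS a b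
    rw [GG_of_NN, GG_of_NN]
    refine Finset.sum_congr rfl fun α _ => ?_
    congr 1
    rw [NN_eq, NN_eq]
    have h1 := h S hS a α
    rw [← h S hS b α] at h1
    have := Nat.eq_of_mul_eq_mul_left (by positivity) h1
    exact_mod_cast this
  · intro h S hS a α
    have key : ∀ b, NN f S b α = NN f S a α := by
      intro b
      have h1 : (2 ^ m : ℤ) * NN f S b α = 2 ^ m * NN f S a α := by
        rw [NN_of_GG, NN_of_GG]
        refine Finset.sum_congr rfl fun v _ => ?_
        congr 1
        by_cases hv : v = 0
        · subst hv
          simp [GG, sgn_zero, card_agree]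
        · exact h v hv S hS b a
      exact mul_left_cancel₀ (by positivity) h1
    have h2 := sum_GG (fun x => if f x = α then (1 : ℤ) else 0) S
    have h3 : ∑ b, GG (fun x => if f x = α then (1 : ℤ) else 0) S b
        = 2 ^ n * NN f S a α := by
      refine (Finset.sum_congr rfl (fun b _ => key b)).trans ?_
      simp [ZMod.card]
    rw [h3, hS] at h2
    have h4 : ∑ x, (if f x = α then (1 : ℤ) else 0)
        = (Nat.card {x : Fin n → ZMod 2 // f x = α} : ℤ) := by
      rw [Nat.card_eq_fintype_card, Fintype.card_subtype, Finset.sum_boole]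
    rw [h4, NN_eq] at h2
    have h5 : (2 : ℤ) ^ n = 2 ^ (n - t) * 2 ^ t := by rw [← pow_add]; congr 1; omega
    rw [h5, mul_assoc] at h2
    have h6 := mul_left_cancel₀ (by positivity) h2
    exact_mod_cast h6

lemma GG_perm {n : ℕ} (e : (Fin n → ZMod 2) → ℤ)
    (he : ∀ π : Equiv.Perm (Fin n), ∀ x : Fin n → ZMod 2, e (fun j => x (π j)) = e x)
    (π : Equiv.Perm (Fin n)) (S T : Finset (Fin n)) (hST : ∀ j, j ∈ S ↔ π j ∈ T)
    (a : Fin n → ZMod 2) : GG e S (fun j => a (π j)) = GG e T a := by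
  unfold GG
  symm
  refine Finset.sum_bij' (fun x _ => fun j => x (π j)) (fun x _ => fun j => x (π.symm j))
    ?_ ?_ ?_ ?_ ?_
  · intro x hx
    simp only [Finset.mem_filter, Finset.mem_univ, true_and] at hx ⊢
    intro j hj; exact hx _ ((hST j).1 hj)
  · intro x hx
    simp only [Finset.mem_filter, Finset.mem_univ, true_and] at hx ⊢
    intro j hj
    have := hx (π.symm j) ((hST _).2 (by simpa using hj))
    simpa using this
  · intro x _; simp
  · intro x _; simp
  · intro x _; exact (he π x).symm

lemma GG_congr {n : ℕ} (e : (Fin n → ZMod 2) → ℤ) (S : Finset (Fin n)) (a b : Fin n → ZMod 2)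
    (h : ∀ j ∈ S, a j = b j) : GG e S a = GG e S b := by
  unfold GG
  congr 1
  ext x
  simp only [Finset.mem_filter, Finset.mem_univ, true_and]
  exact forall₂_congr fun j hj => by rw [h j hj]

lemma const_of_update {n : ℕ} (F : (Fin n → ZMod 2) → ℤ)
    (h : ∀ a j c, F (Function.update a j c) = F a) (a b : Fin n → ZMod 2) : F a = F b := by
  have : ∀ s : Finset (Fin n), F (s.piecewise a b) = F b := by
    intro s
    induction s using Finset.induction_on with
    | empty => simp
    | insert i s hi ih => rw [Finset.piecewise_insert, h, ih]
  simpa using this Finset.univ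

/-- the first `t` coordinates -/
def S0 (n t : ℕ) : Finset (Fin n) := Finset.univ.filter fun j => (j : ℕ) < t

lemma S0_card {n t : ℕ} (htn : t ≤ n) : (S0 n t).card = t := by
  have : S0 n t = Finset.univ.map (Fin.castLEEmb htn) := by
    ext j
    simp only [S0, Finset.mem_filter, Finset.mem_univ, true_and, Finset.mem_map]
    constructor
    · intro h; exact ⟨⟨j, h⟩, rfl⟩
    · rintro ⟨i, rfl⟩; exact i.2
  rw [this]; simp

lemma bin_eq {n : ℕ} (k l : ℕ) (j : Fin n) : bin n k j = bin n l j ↔ k.testBit j = l.testBit j := by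
  unfold bin
  rw [Nat.testBit_eq_decide_div_mod_eq, Nat.testBit_eq_decide_div_mod_eq]
  rcases Nat.mod_two_eq_zero_or_one (k / 2 ^ (j : ℕ)) with h | h <;>
  rcases Nat.mod_two_eq_zero_or_one (l / 2 ^ (j : ℕ)) with h' | h' <;> simp [h, h']

lemma bin_apply {n : ℕ} (k : ℕ) (j : Fin n) : bin n k j = if k.testBit j then 1 else 0 := by
  unfold bin
  rw [Nat.testBit_eq_decide_div_mod_eq]
  rcases Nat.mod_two_eq_zero_or_one (k / 2 ^ (j : ℕ)) with h | h <;> simp [h]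

lemma bin_agree {n t : ℕ} (htn : t ≤ n) (k r : ℕ) (hr : r < 2 ^ t) :
    (∀ j ∈ S0 n t, bin n k j = bin n r j) ↔ k % 2 ^ t = r := by
  simp only [S0, Finset.mem_filter, Finset.mem_univ, true_and, bin_eq]
  constructor
  · intro h
    apply Nat.eq_of_testBit_eq
    intro i
    rw [Nat.testBit_mod_two_pow]
    by_cases hi : i < t
    · simpa [hi] using h ⟨i, by omega⟩ hi
    · have : r.testBit i = false := Nat.testBit_lt_two_pow
        (lt_of_lt_of_le hr (Nat.pow_le_pow_right (by norm_num) (by omega)))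
      simp [hi, this]
  · rintro rfl j hj
    rw [Nat.testBit_mod_two_pow]; simp [hj]

lemma bin_inj {n : ℕ} : Set.InjOn (bin n) (Finset.range (2 ^ n) : Set ℕ) := by
  intro k hk l hl h
  simp only [Finset.coe_range, Set.mem_Iio] at hk hl
  have := (bin_agree le_rfl k l hl).1 (fun j _ => by rw [h])
  rwa [Nat.mod_eq_of_lt hk] at this

lemma bin_image {n : ℕ} : (Finset.range (2 ^ n)).image (bin n) = Finset.univ := by
  apply Finset.eq_univ_of_card
  rw [Finset.card_image_of_injOn bin_inj]
  simp [ZMod.card]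

lemma bin_surj {n : ℕ} (a : Fin n → ZMod 2) : ∃ k, bin n k = a := by
  have : a ∈ (Finset.range (2 ^ n)).image (bin n) := by rw [bin_image]; simp
  obtain ⟨k, _, hk⟩ := Finset.mem_image.1 this
  exact ⟨k, hk⟩

lemma fiber_sum {n t : ℕ} (htn : t ≤ n) (e : (Fin n → ZMod 2) → ℤ) (r : ℕ) (hr : r < 2 ^ t) :
    ∑ k ∈ (Finset.range (2 ^ n)).filter (fun k => k % 2 ^ t = r), e (bin n k)
      = GG e (S0 n t) (bin n r) := by
  unfold GG
  rw [← bin_image, Finset.filter_image, Finset.sum_image]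
  · refine Finset.sum_congr ?_ fun _ _ => rfl
    ext k
    simp only [Finset.mem_filter]
    rw [bin_agree htn k r hr]
  · intro x hx y hy
    exact bin_inj (by simpa using (Finset.mem_filter.1 hx).1)
      (by simpa using (Finset.mem_filter.1 hy).1)

lemma sum_reduce {n t : ℕ} (htn : t ≤ n) (e : (Fin n → ZMod 2) → ℤ) (z : ℂ)
    (hz : z ^ (2 ^ t) = 1) :
    ∑ k ∈ Finset.range (2 ^ n), (e (bin n k) : ℂ) * z ^ k
      = ∑ r ∈ Finset.range (2 ^ t), (GG e (S0 n t) (bin n r) : ℂ) * z ^ r := by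
  rw [← Finset.sum_fiberwise_of_maps_to (s := Finset.range (2 ^ n)) (t := Finset.range (2 ^ t))
    (g := fun k => k % 2 ^ t) (fun k _ => Finset.mem_range.2 (Nat.mod_lt _ (by positivity)))]
  refine Finset.sum_congr rfl fun r hr => ?_
  rw [← fiber_sum htn e r (Finset.mem_range.1 hr)]
  push_cast
  rw [Finset.sum_mul]
  refine Finset.sum_congr rfl fun k hk => ?_
  rw [← (Finset.mem_filter.1 hk).2, ← pow_eq_pow_mod _ hz]

lemma lin_indep {t : ℕ} {z : ℂ} (hz : IsPrimitiveRoot z (2 ^ (t + 1))) (H : ℕ → ℤ)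
    (h : ∑ r ∈ Finset.range (2 ^ (t + 1)), (H r : ℂ) * z ^ r = 0) (r : ℕ) (hr : r < 2 ^ t) :
    H r = H (r + 2 ^ t) := by
  have hneg : z ^ (2 ^ t) = -1 := by
    have h1 : IsPrimitiveRoot (z ^ (2 ^ t)) 2 := hz.pow (by positivity) (by ring)
    exact h1.eq_neg_one_of_two_right
  have hdeg : (minpoly ℚ z).natDegree = 2 ^ t := by
    rw [← Polynomial.cyclotomic_eq_minpoly_rat hz (by positivity), Polynomial.natDegree_cyclotomic,
      Nat.totient_prime_pow_succ Nat.prime_two]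
    simp
  have hl := linearIndependent_pow (K := ℚ) z
  rw [hdeg] at hl
  rw [Fintype.linearIndependent_iff] at hl
  have := hl (fun i => ((H i - H (i + 2 ^ t) : ℤ) : ℚ)) ?_ ⟨r, hr⟩
  · have h2 : H r - H (r + 2 ^ t) = 0 := by exact_mod_cast this
    omega
  · rw [pow_succ, mul_two, Finset.sum_range_add] at h
    rw [← h, ← Finset.sum_add_distrib, Finset.sum_range]
    refine Finset.sum_congr rfl fun i _ => ?_
    rw [pow_add, hneg, Algebra.smul_def]
    simp only [eq_ratCast]
    push_cast
    rw [add_comm (2 ^ t) (i : ℕ)]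
    ring

lemma main_iff {n t : ℕ} (htn : t + 1 ≤ n) (e : (Fin n → ZMod 2) → ℤ)
    (he : ∀ π : Equiv.Perm (Fin n), ∀ x : Fin n → ZMod 2, e (fun j => x (π j)) = e x)
    (z : ℂ) (hz : IsPrimitiveRoot z (2 ^ (t + 1))) :
    (∀ S : Finset (Fin n), S.card = t + 1 → ∀ a b, GG e S a = GG e S b) ↔
      ∑ k ∈ Finset.range (2 ^ n), (e (bin n k) : ℂ) * z ^ k = 0 := by
  rw [sum_reduce htn e z hz.pow_eq_one]
  constructor
  · intro h
    rw [Finset.sum_congr rfl (fun r _ => by rw [h _ (S0_card htn) (bin n r) 0]),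
      ← Finset.mul_sum, hz.geom_sum_eq_zero (Nat.one_lt_two_pow (by omega)), mul_zero]
  · intro h
    have hH := lin_indep hz (fun r => GG e (S0 n (t + 1)) (bin n r)) h
    have htop : ∀ (a : Fin n → ZMod 2) (c : ZMod 2),
        GG e (S0 n (t + 1)) (Function.update a ⟨t, htn⟩ c)
          = GG e (S0 n (t + 1)) (Function.update a ⟨t, htn⟩ 0) := by
      intro a c
      obtain ⟨k, rfl⟩ := bin_surj a
      have hr : k % 2 ^ t < 2 ^ t := Nat.mod_lt _ (by positivity)
      have h1 := hH (k % 2 ^ t) hr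
      have e0 : GG e (S0 n (t + 1)) (bin n (k % 2 ^ t))
          = GG e (S0 n (t + 1)) (Function.update (bin n k) ⟨t, htn⟩ 0) := by
        apply GG_congr
        intro j hj
        simp only [S0, Finset.mem_filter, Finset.mem_univ, true_and] at hj
        by_cases hjt : j = ⟨t, htn⟩
        · subst hjt
          rw [Function.update_self, bin_apply, Nat.testBit_mod_two_pow]; simp
        · have : (j : ℕ) < t := by
            have : (j : ℕ) ≠ t := fun h => hjt (Fin.ext h)
            omega
          rw [Function.update_of_ne hjt, bin_apply, bin_apply, Nat.testBit_mod_two_pow]; simp [this]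
      have e1 : GG e (S0 n (t + 1)) (bin n (k % 2 ^ t + 2 ^ t))
          = GG e (S0 n (t + 1)) (Function.update (bin n k) ⟨t, htn⟩ 1) := by
        apply GG_congr
        intro j hj
        simp only [S0, Finset.mem_filter, Finset.mem_univ, true_and] at hj
        rw [add_comm]
        by_cases hjt : j = ⟨t, htn⟩
        · subst hjt
          rw [Function.update_self, bin_apply, Nat.testBit_two_pow_add_eq,
            Nat.testBit_mod_two_pow]; simp
        · have : (j : ℕ) < t := by
            have : (j : ℕ) ≠ t := fun h => hjt (Fin.ext h)
            omega
          rw [Function.update_of_ne hjt, bin_apply, bin_apply, Nat.testBit_two_pow_add_gt this,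
            Nat.testBit_mod_two_pow]; simp [this]
      rw [e0, e1] at h1
      have hc : c = 0 ∨ c = 1 := by revert c; decide
      rcases hc with rfl | rfl
      · rfl
      · exact h1.symm
    have htop' : ∀ (a : Fin n → ZMod 2) (c : ZMod 2),
        GG e (S0 n (t + 1)) (Function.update a ⟨t, htn⟩ c) = GG e (S0 n (t + 1)) a := by
      intro a c
      rw [htop a c, ← htop a (a ⟨t, htn⟩), Function.update_eq_self]
    have hupd : ∀ a j c, GG e (S0 n (t + 1)) (Function.update a j c) = GG e (S0 n (t + 1)) a := by
      intro a j c
      by_cases hj : j ∈ S0 n (t + 1)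
      · have hsw : ∀ i, i ∈ S0 n (t + 1) ↔ Equiv.swap j ⟨t, htn⟩ i ∈ S0 n (t + 1) := by
          have hT : (⟨t, htn⟩ : Fin n) ∈ S0 n (t + 1) := by simp [S0]
          intro i
          rw [Equiv.swap_apply_def]
          split_ifs with h1 h2
          · subst h1; simp [hj, hT]
          · subst h2; simp [hj, hT]
          · rfl
        rw [← GG_perm e he (Equiv.swap j ⟨t, htn⟩) _ _ hsw,
          ← GG_perm e he (Equiv.swap j ⟨t, htn⟩) _ _ hsw a,
          ← htop' (fun i => a (Equiv.swap j ⟨t, htn⟩ i)) c]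
        congr 1
        ext i
        by_cases hi : i = ⟨t, htn⟩
        · subst hi; simp
        · have : Equiv.swap j ⟨t, htn⟩ i ≠ j := by
            intro h; apply hi
            have := congrArg (Equiv.swap j ⟨t, htn⟩) h
            simpa using this
          rw [Function.update_of_ne this, Function.update_of_ne hi]
      · apply GG_congr
        intro i hi
        rw [Function.update_of_ne]
        rintro rfl; exact hj hi
    intro S hS a b
    let ε : {x // x ∈ S0 n (t + 1)} ≃ {x // x ∈ S} :=
      Finset.equivOfCardEq (by rw [S0_card htn, hS])
    have hπ : ∀ j, j ∈ S0 n (t + 1) ↔ ε.extendSubtype j ∈ S := by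
      intro j
      constructor
      · intro h; exact ε.extendSubtype_mem j h
      · intro h; by_contra h'; exact ε.extendSubtype_not_mem j h' h
    rw [← GG_perm e he ε.extendSubtype _ _ hπ a, ← GG_perm e he ε.extendSubtype _ _ hπ b]
    exact const_of_update _ hupd _ _

lemma omega_prim (n : ℕ) : IsPrimitiveRoot (ω n) (2 ^ n) := by
  have := Complex.isPrimitiveRoot_exp (2 ^ n) (by positivity)
  unfold ω
  push_cast at this
  exact this

/-- A symmetric multi-output Boolean function `f : 𝔽₂ⁿ → 𝔽₂^m` is `t`-th order
correlation-immune iff `ℱ_{v·f}(2^{n-t}) = 0` for every nonzero `v ∈ 𝔽₂^m`. -/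
theorem stmt4 (n m t : ℕ) (hn : 0 < n) (hm : 0 < m) (ht : 0 < t) (htn : t ≤ n)
    (f : (Fin n → ZMod 2) → (Fin m → ZMod 2))
    (hsym : ∀ π : Equiv.Perm (Fin n), ∀ x : Fin n → ZMod 2, f (fun j => x (π j)) = f x) :
    CI t f ↔ ∀ v : Fin m → ZMod 2, v ≠ 0 →
      ∑ k ∈ Finset.range (2 ^ n),
        (-1 : ℂ) ^ (∑ i, v i * f (bin n k) i).val *
          ω n ^ (-(k * 2 ^ (n - t) : ℤ)) = 0 := by
  obtain ⟨t, rfl⟩ : ∃ s, t = s + 1 := ⟨t - 1, by omega⟩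
  have hz : IsPrimitiveRoot ((ω n ^ (2 ^ (n - (t + 1))))⁻¹) (2 ^ (t + 1)) :=
    ((omega_prim n).pow (by positivity) (by rw [← pow_add]; congr 1; omega)).inv
  rw [CI_iff htn]
  refine forall₂_congr fun v _ => ?_
  rw [main_iff htn (fun x => sgn (∑ i, v i * f x i)) (fun π x => by simp only [hsym]) _ hz]
  have : ∀ k ∈ Finset.range (2 ^ n), ((sgn (∑ i, v i * f (bin n k) i) : ℤ) : ℂ)
        * ((ω n ^ (2 ^ (n - (t + 1))))⁻¹) ^ k
      = (-1 : ℂ) ^ (∑ i, v i * f (bin n k) i).val *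
          ω n ^ (-(k * 2 ^ (n - (t + 1)) : ℤ)) := by
    intro k _
    congr 1
    · simp [sgn]
    · rw [zpow_neg, inv_pow, ← pow_mul, mul_comm]
      congr 1
  rw [Finset.sum_congr rfl this]
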